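/- Fix integers T ≥ 1, N ≥ 1 and a real β > 0. Let ℓ_1,…,ℓ_T, m_1,…,m_T ∈ ℝ^N. Define w_t ∈ Δ_N by w_{t,i} = exp(−β(Σ_{s=1}^{t−1} ℓ_{s,i} + m_{t,i})) / Σ_{j=1}^N exp(−β(Σ_{s=1}^{t−1} ℓ_{s,j} + m_{t,j})) for t = 1,…,T, and w'_t ∈ Δ_N by w'_{t,i} = exp(−β Σ_{s=1}^{t} ℓ_{s,i}) / Σ_{j=1}^N exp(−β Σ_{s=1}^{t} ℓ_{s,j}) for t = 0,…,T (so w'_0 is uniform). Then for every w* ∈ Δ_N: Σ_{t=1}^T ⟨ℓ_t, w_t − w*⟩ ≤ (ln N + Σ_{i=1}^N w*_i ln w*_i)/β + β Σ_{t=1}^T ‖ℓ_t − m_t‖_∞² − (1/(2β)) Σ_{t=1}^T (‖w_t − w'_t‖_1² + ‖w_t − w'_{t−1}‖_1²). -/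

import Mathlib

open Finset

/-- Relative entropy of finitely supported weight vectors. -/
noncomputable def relEntropy {ι : Type*} [Fintype ι] (p q : ι → ℝ) : ℝ :=
  ∑ i, p i * (Real.log (p i) - Real.log (q i))

/-- Gibbs weights with potential `a`. -/
noncomputable def gibbs {ι : Type*} [Fintype ι] (a : ι → ℝ) (i : ι) : ℝ :=
  Real.exp (a i) / ∑ j, Real.exp (a j)

lemma log_ge_rational {t : ℝ} (ht : 0 < t) :
    (5 * t ^ 2 - 4 * t - 1) / (2 * t ^ 2 + 4 * t) ≤ Real.log t := by
  let f : ℝ → ℝ := fun x => Real.log x - (5 * x ^ 2 - 4 * x - 1) / (2 * x ^ 2 + 4 * x)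
  have hder : ∀ x : ℝ, 0 < x → HasDerivAt f ((x - 1) ^ 3 / (x ^ 2 * (x + 2) ^ 2)) x := by
    intro x hx
    have hden : 2 * x ^ 2 + 4 * x ≠ 0 := by positivity
    have h1 : HasDerivAt (fun x : ℝ => 5 * x ^ 2 - 4 * x - 1) (10 * x - 4) x :=
      ((((hasDerivAt_pow 2 x).const_mul 5).sub
        ((hasDerivAt_id x).const_mul 4)).sub_const 1).congr_deriv (by norm_num; ring)
    have h2 : HasDerivAt (fun x : ℝ => 2 * x ^ 2 + 4 * x) (4 * x + 4) x :=
      (((hasDerivAt_pow 2 x).const_mul 2).add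
        ((hasDerivAt_id x).const_mul 4)).congr_deriv (by norm_num; ring)
    refine ((Real.hasDerivAt_log hx.ne').sub (h1.div h2 hden)).congr_deriv ?_
    have hx2 : x + 2 ≠ 0 := by positivity
    have : 2 * x ^ 2 + 4 * x = 2 * x * (x + 2) := by ring
    rw [this]
    field_simp
    ring
  have hf1 : f 1 = 0 := by norm_num [f]
  have hcont : ∀ s : Set ℝ, (∀ x ∈ s, 0 < x) → ContinuousOn f s := fun s hs x hx =>
    (hder x (hs x hx)).continuousAt.continuousWithinAt
  suffices h : 0 ≤ f t by simpa [f] using h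
  rcases le_total t 1 with h | h
  · have hanti : AntitoneOn f (Set.Icc t 1) := by
      refine antitoneOn_of_deriv_nonpos (convex_Icc t 1)
        (hcont _ fun x hx => ht.trans_le hx.1) ?_ ?_ <;> rw [interior_Icc]
      · exact fun x hx => (hder x (ht.trans hx.1)).differentiableAt.differentiableWithinAt
      · intro x hx
        rw [(hder x (ht.trans hx.1)).deriv]
        refine div_nonpos_of_nonpos_of_nonneg ?_ (by positivity)
        exact Odd.pow_nonpos (by decide) (by linarith [hx.2])
    exact hf1 ▸ hanti ⟨le_rfl, h⟩ ⟨h, le_rfl⟩ h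
  · have hmono : MonotoneOn f (Set.Icc 1 t) := by
      refine monotoneOn_of_deriv_nonneg (convex_Icc 1 t)
        (hcont _ fun x hx => one_pos.trans_le hx.1) ?_ ?_ <;> rw [interior_Icc]
      · exact fun x hx => (hder x (one_pos.trans hx.1)).differentiableAt.differentiableWithinAt
      · intro x hx
        rw [(hder x (one_pos.trans hx.1)).deriv]
        have : 0 ≤ x - 1 := by linarith [hx.1]
        positivity
    exact hf1 ▸ hmono ⟨le_rfl, h⟩ ⟨h, le_rfl⟩ h

lemma mul_log_sub_log_ge {p q : ℝ} (hp : 0 ≤ p) (hq : 0 < q) :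
    (p - q) + 3 / 2 * ((p - q) ^ 2 / (p + 2 * q)) ≤ p * (Real.log p - Real.log q) := by
  rcases hp.eq_or_lt with rfl | hp
  · have : (0 - q) ^ 2 / (0 + 2 * q) = q / 2 := by field_simp; ring
    rw [this]; linarith
  · have h := mul_le_mul_of_nonneg_left (log_ge_rational (div_pos hp hq)) hp.le
    rw [Real.log_div hp.ne' hq.ne'] at h
    refine le_trans (le_of_eq ?_) h
    have h1 : p + 2 * q ≠ 0 := by positivity
    have h2 : 2 * (p / q) ^ 2 + 4 * (p / q) = 2 * p * (p + 2 * q) / q ^ 2 := by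
      field_simp; ring
    rw [h2]
    field_simp
    ring

section

variable {ι : Type*} [Fintype ι]

/-- Pinsker's inequality for finite probability vectors. -/
lemma sq_sum_abs_sub_le_relEntropy {p q : ι → ℝ} (hp : ∀ i, 0 ≤ p i) (hq : ∀ i, 0 < q i)
    (hp1 : ∑ i, p i = 1) (hq1 : ∑ i, q i = 1) :
    (∑ i, |p i - q i|) ^ 2 / 2 ≤ relEntropy p q := by
  have hpos : ∀ i, 0 < p i + 2 * q i := fun i => by linarith [hp i, hq i]
  have h1 : ∑ i, ((p i - q i) + 3 / 2 * ((p i - q i) ^ 2 / (p i + 2 * q i))) ≤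
      relEntropy p q := sum_le_sum fun i _ => mul_log_sub_log_ge (hp i) (hq i)
  rw [sum_add_distrib, sum_sub_distrib, hp1, hq1, ← mul_sum] at h1
  have h3 := sum_sq_le_sum_mul_sum_of_sq_le_mul univ (r := fun i => |p i - q i|)
    (f := fun i => (p i - q i) ^ 2 / (p i + 2 * q i)) (g := fun i => p i + 2 * q i)
    (fun i _ => div_nonneg (sq_nonneg _) (hpos i).le) (fun i _ => (hpos i).le)
    (fun i _ => by rw [sq_abs, div_mul_cancel₀ _ (hpos i).ne'])
  rw [sum_add_distrib, ← mul_sum, hp1, hq1] at h3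
  linarith

lemma sum_mul_le_norm_mul_sum_abs (a b : ι → ℝ) : ∑ i, a i * b i ≤ ‖a‖ * ∑ i, |b i| := by
  rw [mul_sum]
  refine sum_le_sum fun i _ => (le_abs_self _).trans ?_
  rw [abs_mul]
  exact mul_le_mul_of_nonneg_right (norm_le_pi_norm a i) (abs_nonneg _)

variable [Nonempty ι]

lemma sum_exp_pos (a : ι → ℝ) : 0 < ∑ j, Real.exp (a j) :=
  sum_pos (fun _ _ => Real.exp_pos _) univ_nonempty

lemma gibbs_pos (a : ι → ℝ) (i : ι) : 0 < gibbs a i :=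
  div_pos (Real.exp_pos _) (sum_exp_pos a)

lemma sum_gibbs (a : ι → ℝ) : ∑ i, gibbs a i = 1 := by
  simp only [gibbs, ← sum_div]
  exact div_self (sum_exp_pos a).ne'

lemma relEntropy_gibbs {p : ι → ℝ} (hp : ∑ i, p i = 1) (a : ι → ℝ) :
    relEntropy p (gibbs a) =
      ∑ i, p i * Real.log (p i) - ∑ i, p i * a i + Real.log (∑ j, Real.exp (a j)) := by
  have h : ∀ i, Real.log (gibbs a i) = a i - Real.log (∑ j, Real.exp (a j)) := fun i => by
    rw [gibbs, Real.log_div (Real.exp_pos _).ne' (sum_exp_pos a).ne', Real.log_exp]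
  simp only [relEntropy, h, mul_sub, sum_sub_distrib, ← sum_mul, hp]
  ring

lemma sum_gibbs_mul_log (a : ι → ℝ) :
    ∑ i, gibbs a i * Real.log (gibbs a i) =
      ∑ i, gibbs a i * a i - Real.log (∑ j, Real.exp (a j)) := by
  have h := relEntropy_gibbs (sum_gibbs a) a
  simp only [relEntropy, sub_self, mul_zero, sum_const_zero] at h
  linarith

/-- Gibbs weights are Lipschitz from the sup norm to the ℓ1 norm. -/
lemma sum_abs_gibbs_sub_le (a b : ι → ℝ) : ∑ i, |gibbs a i - gibbs b i| ≤ ‖a - b‖ := by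
  set S := ∑ i, |gibbs a i - gibbs b i| with hS
  have hS0 : 0 ≤ S := sum_nonneg fun _ _ => abs_nonneg _
  have h1 := sq_sum_abs_sub_le_relEntropy (fun i => (gibbs_pos a i).le) (gibbs_pos b)
    (sum_gibbs a) (sum_gibbs b)
  have h2 := sq_sum_abs_sub_le_relEntropy (fun i => (gibbs_pos b i).le) (gibbs_pos a)
    (sum_gibbs b) (sum_gibbs a)
  simp only [abs_sub_comm (gibbs b _)] at h2
  rw [relEntropy_gibbs (sum_gibbs _), sum_gibbs_mul_log] at h1 h2
  have h3 := sum_mul_le_norm_mul_sum_abs (a - b) (fun i => gibbs a i - gibbs b i)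
  have h4 : ∑ i, (a - b) i * (gibbs a i - gibbs b i) =
      ∑ i, gibbs a i * a i - ∑ i, gibbs a i * b i
        + (∑ i, gibbs b i * b i - ∑ i, gibbs b i * a i) := by
    simp only [← sum_sub_distrib, ← sum_add_distrib, Pi.sub_apply]
    exact sum_congr rfl fun i _ => by ring
  rw [← hS] at h1 h2 h3
  have h5 : S * S ≤ ‖a - b‖ * S := by nlinarith
  rcases hS0.eq_or_lt with h | h
  · exact h ▸ norm_nonneg _
  · exact le_of_mul_le_mul_right h5 h

/-- One round of optimistic Hedge, from cumulative loss `L`, with loss `l` and prediction `μ`. -/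
lemma optimistic_hedge_step {β : ℝ} (hβ : 0 < β) (L l μ x : ι → ℝ) (hx1 : ∑ i, x i = 1) :
    ∑ i, l i * (gibbs (fun i => -β * (L i + μ i)) i - x i) ≤
      (relEntropy x (gibbs fun i => -β * L i)
          - relEntropy x (gibbs fun i => -β * (L i + l i))) / β
        + β * ‖l - μ‖ ^ 2
        - 1 / (2 * β) * ((∑ i, |gibbs (fun i => -β * (L i + μ i)) i
              - gibbs (fun i => -β * (L i + l i)) i|) ^ 2
            + (∑ i, |gibbs (fun i => -β * (L i + μ i)) i
              - gibbs (fun i => -β * L i) i|) ^ 2) := by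
  set a : ι → ℝ := fun i => -β * (L i + μ i) with ha
  set b : ι → ℝ := fun i => -β * (L i + l i) with hb
  set c : ι → ℝ := fun i => -β * L i with hc
  have h1 := sq_sum_abs_sub_le_relEntropy (fun i => (gibbs_pos b i).le) (gibbs_pos a)
    (sum_gibbs b) (sum_gibbs a)
  have h2 := sq_sum_abs_sub_le_relEntropy (fun i => (gibbs_pos a i).le) (gibbs_pos c)
    (sum_gibbs a) (sum_gibbs c)
  simp only [abs_sub_comm (gibbs b _)] at h1
  have hid : relEntropy (gibbs b) (gibbs a) + relEntropy (gibbs a) (gibbs c)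
      + β * ∑ i, l i * (gibbs a i - x i) =
      relEntropy x (gibbs c) - relEntropy x (gibbs b)
        + β * ∑ i, (l - μ) i * (gibbs a i - gibbs b i) := by
    have h : ∑ i, gibbs b i * (b i - a i) + ∑ i, gibbs a i * (a i - c i)
        + β * ∑ i, l i * (gibbs a i - x i) = ∑ i, x i * (b i - c i)
        + β * ∑ i, (l - μ) i * (gibbs a i - gibbs b i) := by
      simp only [mul_sum, ← sum_add_distrib]
      refine sum_congr rfl fun i _ => ?_
      simp only [Pi.sub_apply, ha, hb, hc]
      ring
    simp only [mul_sub (gibbs b _) (b _), mul_sub (gibbs a _) (a _), mul_sub (x _) (b _),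
      sum_sub_distrib] at h
    rw [relEntropy_gibbs (sum_gibbs b), relEntropy_gibbs (sum_gibbs a), relEntropy_gibbs hx1,
      relEntropy_gibbs hx1, sum_gibbs_mul_log, sum_gibbs_mul_log]
    linarith
  have hlip := sum_abs_gibbs_sub_le a b
  have hab : ‖a - b‖ = β * ‖l - μ‖ := by
    have : a - b = β • (l - μ) := by
      ext i; simp only [Pi.sub_apply, Pi.smul_apply, smul_eq_mul, ha, hb]; ring
    rw [this, norm_smul, Real.norm_of_nonneg hβ.le]
  have h3 := (sum_mul_le_norm_mul_sum_abs (l - μ) (fun i => gibbs a i - gibbs b i)).trans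
    (mul_le_mul_of_nonneg_left (hlip.trans_eq hab) (norm_nonneg _))
  refine le_of_mul_le_mul_left ?_ hβ
  have h4 := mul_le_mul_of_nonneg_left h3 hβ.le
  have hrhs : ∀ A B C : ℝ, β * (A / β + B - 1 / (2 * β) * C) = A + β * B - C / 2 := by
    intro A B C; field_simp
  rw [hrhs]
  linarith

end

/-- Key intermediate inequality for Optimistic Hedge: with played weights `w t`
(Optimistic Hedge) and regularized leaders `w' t` (Hedge on realized losses),
for every `w* ∈ Δ_N`,
`∑_{t=1}^T ⟨ℓ_t, w_t - w*⟩ ≤ (ln N + ∑_i w*_i ln w*_i)/β + β ∑ ‖ℓ_t - m_t‖_∞²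
  - (1/(2β)) ∑_{t=1}^T (‖w_t - w'_t‖_1² + ‖w_t - w'_{t-1}‖_1²)`.
The norm on `Fin N → ℝ` is the sup norm; `∑ j, |·|` is the ℓ1 norm. -/
theorem optimistic_hedge_key_inequality (T N : ℕ) (hT : 1 ≤ T) (hN : 1 ≤ N)
    (β : ℝ) (hβ : 0 < β)
    (ℓ m : ℕ → Fin N → ℝ) (w w' : ℕ → Fin N → ℝ)
    (hw : ∀ t i, w t i =
      Real.exp (-β * ((∑ s ∈ Finset.Icc 1 (t - 1), ℓ s i) + m t i)) /
        ∑ j, Real.exp (-β * ((∑ s ∈ Finset.Icc 1 (t - 1), ℓ s j) + m t j)))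
    (hw' : ∀ t i, w' t i =
      Real.exp (-β * ∑ s ∈ Finset.Icc 1 t, ℓ s i) /
        ∑ j, Real.exp (-β * ∑ s ∈ Finset.Icc 1 t, ℓ s j)) :
    ∀ wstar : Fin N → ℝ, (∀ i, 0 ≤ wstar i) → (∑ i, wstar i = 1) →
      ∑ t ∈ Finset.Icc 1 T, ∑ j, ℓ t j * (w t j - wstar j) ≤
        (Real.log N + ∑ i, wstar i * Real.log (wstar i)) / β
          + β * ∑ t ∈ Finset.Icc 1 T, ‖ℓ t - m t‖ ^ 2
          - (1 / (2 * β)) * ∑ t ∈ Finset.Icc 1 T,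
              ((∑ j, |w t j - w' t j|) ^ 2 + (∑ j, |w t j - w' (t - 1) j|) ^ 2) := by
  intro x hx hx1
  have : Nonempty (Fin N) := ⟨⟨0, hN⟩⟩
  have hwg : ∀ t, w t = gibbs fun i => -β * ((∑ s ∈ Icc 1 (t - 1), ℓ s i) + m t i) :=
    fun t => funext (hw t)
  have hwg' : ∀ t, w' t = gibbs fun i => -β * ∑ s ∈ Icc 1 t, ℓ s i :=
    fun t => funext (hw' t)
  have hstep : ∀ t ∈ Icc 1 T, ∑ j, ℓ t j * (w t j - x j) ≤
      (relEntropy x (w' (t - 1)) - relEntropy x (w' t)) / β + β * ‖ℓ t - m t‖ ^ 2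
        - 1 / (2 * β) * ((∑ j, |w t j - w' t j|) ^ 2 + (∑ j, |w t j - w' (t - 1) j|) ^ 2) := by
    intro t ht
    obtain ⟨k, rfl⟩ := Nat.exists_eq_add_of_le' (mem_Icc.1 ht).1
    have h := optimistic_hedge_step hβ (fun i => ∑ s ∈ Icc 1 k, ℓ s i) (ℓ (k + 1)) (m (k + 1))
      x hx1
    simpa only [hwg, hwg', Nat.add_sub_cancel,
      sum_Icc_succ_top (Nat.le_add_left 1 k)] using h
  have htel : ∑ t ∈ Icc 1 T, (relEntropy x (w' (t - 1)) - relEntropy x (w' t)) =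
      relEntropy x (w' 0) - relEntropy x (w' T) := by
    rw [← sum_range_sub' (fun t => relEntropy x (w' t)), range_eq_Ico]
    exact (sum_Ico_add' (fun t => relEntropy x (w' (t - 1)) - relEntropy x (w' t)) 0 T 1).symm
  have h0 : relEntropy x (w' 0) = Real.log N + ∑ i, x i * Real.log (x i) := by
    rw [hwg', relEntropy_gibbs hx1]
    simp [add_comm]
  have hT0 : 0 ≤ relEntropy x (w' T) := by
    rw [hwg']
    exact (by positivity : (0 : ℝ) ≤ _).trans
      (sq_sum_abs_sub_le_relEntropy hx (gibbs_pos _) hx1 (sum_gibbs _))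
  have hsum := sum_le_sum hstep
  rw [sum_sub_distrib, sum_add_distrib, ← sum_div, ← mul_sum, ← mul_sum, htel, h0] at hsum
  have hdiv := div_le_div_of_nonneg_right (sub_le_self
    (Real.log N + ∑ i, x i * Real.log (x i)) hT0) hβ.le
  linarith
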